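/- In the binary reduction, the exact mismatch count is HD(R, C) = 2·(x − |{k ∈ Fin x : f k = true and g k = true}|), where x is a natural number, f, g : Fin x → Bool, R = concat over k of E(encA(f k)), C = concat over k of E(encB(g k)), with encA(true) = encB(true) = 0, encA(false) = 1, encB(false) = 2, and E : Fin 3 → List Bool given by E(0) = [0,1,1], E(1) = [1,0,1], E(2) = [1,1,0]. -/

import Mathlib

/-- Truncated Hamming distance: number of indices `k < min |s| |t|` with `s[k] ≠ t[k]`. -/
def HD {α : Type*} [DecidableEq α] (s t : List α) : ℕ :=
  ((s.zip t).filter (fun p => p.1 ≠ p.2)).length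

/-- Encoding of entries of the matrix `A`: `1 ↦ '1'`, `0 ↦ 'x'`. -/
def encA : Bool → Fin 3 := fun a => if a then 0 else 1

/-- Encoding of entries of the matrix `B`: `1 ↦ '1'`, `0 ↦ 'y'`. -/
def encB : Bool → Fin 3 := fun b => if b then 0 else 2

/-- Binary codewords `'011'`, `'101'`, `'110'` for the three characters. -/
def E : Fin 3 → List Bool
  | 0 => [false, true, true]
  | 1 => [true, false, true]
  | 2 => [true, true, false]

theorem HD_append {α : Type*} [DecidableEq α] {s t : List α} (h : s.length = t.length)
    (u v : List α) : HD (s ++ u) (t ++ v) = HD s t + HD u v := by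
  simp [HD, List.zip_append h]

theorem HD_flatMap {ι α : Type*} [DecidableEq α] (u v : ι → List α)
    (h : ∀ i, (u i).length = (v i).length) (l : List ι) :
    HD (l.flatMap u) (l.flatMap v) = (l.map fun i => HD (u i) (v i)).sum := by
  induction l with
  | nil => rfl
  | cons i l ih => simp [HD_append (h i), ih]

theorem length_E (c : Fin 3) : (E c).length = 3 := by
  fin_cases c <;> rfl

theorem HD_E_encA_encB (a b : Bool) :
    HD (E (encA a)) (E (encB b)) = if ¬(a = true ∧ b = true) then 2 else 0 := by
  cases a <;> cases b <;> rfl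

theorem binary_reduction_exact_count (x : ℕ) (f g : Fin x → Bool)
    (R C : List Bool)
    (hR : R = (List.finRange x).flatMap (fun k => E (encA (f k))))
    (hC : C = (List.finRange x).flatMap (fun k => E (encB (g k)))) :
    HD R C =
      2 * (x - (Finset.univ.filter (fun k : Fin x => f k = true ∧ g k = true)).card) := by
  subst hR hC
  rw [HD_flatMap _ _ fun k => by simp only [length_E], ← Fin.sum_univ_def]
  simp only [HD_E_encA_encB]
  rw [← Finset.sum_filter, Finset.sum_const, smul_eq_mul, mul_comm]
  have h := Finset.card_filter_add_card_filter_not (s := (Finset.univ : Finset (Fin x)))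
    (fun k => f k = true ∧ g k = true)
  rw [Finset.card_univ, Fintype.card_fin] at h
  rw [← Nat.eq_sub_of_add_eq' h]
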